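/- In the canonical two-stage model, let θ = (β, μ, ρ, σ, τ) and let P_θ denote the joint law of (X*, Y*) on ℝ^{ℓ+s} × ℝ^{ℓ+s}. Let g_β ∈ ℝ, g_z ∈ O(ℓ), g_r ∈ O(s), and let q_g = blockdiag(g_z, g_r). Then the pushforward of P_θ under the map (x, y) ↦ (q_g x, q_g(y + g_β x)) equals P_{θ'}, where θ' = (β + g_β, g_z μ, ρ, σ, τ). -/

import Mathlib

open MeasureTheory ProbabilityTheory Matrix

/-- Marginal law of `X* = (X*_z, X*_r)` in the canonical two-stage model:
independent coordinates, `X*_z ~ N(μ, τ²I_ℓ)` and `X*_r ~ N(0, τ²I_s)`. -/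
noncomputable def lawX (ℓ s : ℕ) (μ : Fin ℓ → ℝ) (τ : ℝ) :
    Measure (Fin ℓ ⊕ Fin s → ℝ) :=
  Measure.pi fun i => gaussianReal (Sum.elim μ (0 : Fin s → ℝ) i) (τ ^ 2).toNNReal

/-- Conditional law of `Y*` given `X* = x`: independent coordinates with
`Y*_i ~ N(x_i β + (x_i − μ₀_i)(ρσ/τ), (1−ρ²)σ²)`, where `μ₀ = (μ', 0'_s)'`. -/
noncomputable def lawYgiven (ℓ s : ℕ) (μ : Fin ℓ → ℝ) (β ρ σ τ : ℝ)
    (x : Fin ℓ ⊕ Fin s → ℝ) : Measure (Fin ℓ ⊕ Fin s → ℝ) :=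
  Measure.pi fun i =>
    gaussianReal (x i * β + (x i - Sum.elim μ (0 : Fin s → ℝ) i) * (ρ * σ / τ))
      ((1 - ρ ^ 2) * σ ^ 2).toNNReal

/-- Joint law `P_θ` of `(X*, Y*)`: the composition (bind) of the marginal law of `X*`
with the conditional Gaussian law of `Y*` given `X*`. -/
noncomputable def jointLaw (ℓ s : ℕ) (μ : Fin ℓ → ℝ) (β ρ σ τ : ℝ) :
    Measure ((Fin ℓ ⊕ Fin s → ℝ) × (Fin ℓ ⊕ Fin s → ℝ)) :=
  (lawX ℓ s μ τ).bind fun x =>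
    (lawYgiven ℓ s μ β ρ σ τ x).map fun y => (x, y)

/-- An orthogonal matrix maps a Gaussian vector with independent coordinates of common variance
to a Gaussian vector of the same kind, with rotated mean. -/
theorem pi_gaussianReal_map_mulVec {ι : Type*} [Fintype ι] [DecidableEq ι] (Q : Matrix ι ι ℝ)
    (hQ : Qᵀ * Q = 1) (m : ι → ℝ) (v : NNReal) :
    (Measure.pi fun i => gaussianReal (m i) v).map Q.mulVec =
      Measure.pi fun i => gaussianReal (Q.mulVec m i) v := by
  have hQm : Measurable Q.mulVec := Q.mulVecLin.continuous_of_finiteDimensional.measurable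
  have : IsProbabilityMeasure ((Measure.pi fun i => gaussianReal (m i) v).map Q.mulVec) :=
    Measure.isProbabilityMeasure_map hQm.aemeasurable
  refine charFun_eq_pi_iff.1 fun t => ?_
  have hadj : charFun (((Measure.pi fun i => gaussianReal (m i) v).map Q.mulVec).map
        (WithLp.toLp 2)) t =
      charFun ((Measure.pi fun i => gaussianReal (m i) v).map (WithLp.toLp 2))
        (WithLp.toLp 2 (Qᵀ.mulVec t)) := by
    rw [Measure.map_map (by fun_prop) hQm, charFun_apply, charFun_apply,
      integral_map (Measurable.aemeasurable (by fun_prop))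
        (Measurable.aestronglyMeasurable (by fun_prop)),
      integral_map (Measurable.aemeasurable (by fun_prop))
        (Measurable.aestronglyMeasurable (by fun_prop))]
    congr with x
    simp only [Function.comp_apply, EuclideanSpace.inner_eq_star_dotProduct, star_trivial]
    rw [dotProduct_mulVec, mulVec_transpose]
  have hmean : ∑ i, Qᵀ.mulVec t i * m i = ∑ i, t i * Q.mulVec m i := by
    change Qᵀ.mulVec t ⬝ᵥ m = t.ofLp ⬝ᵥ Q.mulVec m
    rw [dotProduct_mulVec, mulVec_transpose]
  have hnorm : ∑ i, Qᵀ.mulVec t i ^ 2 = ∑ i, t i ^ 2 := by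
    simp only [pow_two]
    change Qᵀ.mulVec t ⬝ᵥ Qᵀ.mulVec t = t.ofLp ⬝ᵥ t.ofLp
    rw [dotProduct_mulVec, mulVec_transpose, vecMul_vecMul, mul_eq_one_comm.1 hQ, vecMul_one]
  rw [hadj, charFun_pi]
  simp_rw [charFun_gaussianReal, ← Complex.exp_sum, Finset.sum_sub_distrib, ← Finset.sum_div,
    ← Finset.sum_mul, ← Finset.mul_sum]
  congr 2
  · exact_mod_cast congrArg (fun r : ℝ => (r : ℂ) * Complex.I) hmean
  · exact_mod_cast congrArg (fun r : ℝ => (v : ℂ) * (r : ℂ) / 2) hnorm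

/-- A bind along translates of a fixed measure is the image of a product measure. -/
theorem bind_map_prodMk_map_add {E F : Type*} [MeasurableSpace E] [MeasurableSpace F] [Add F]
    [MeasurableAdd₂ F] (κ : Measure E) (ν : Measure F) [SFinite ν] (c : E → F)
    (hc : Measurable c) :
    (κ.bind fun x => (ν.map fun w => c x + w).map fun y => (x, y)) =
      (κ.prod ν).map fun p => (p.1, c p.1 + p.2) := by
  have hf : Measurable fun p : E × F => (p.1, c p.1 + p.2) := by fun_prop
  have hmap : (fun x => (ν.map fun w => c x + w).map fun y => (x, y)) =
      fun x => (ν.map (Prod.mk x)).map fun p : E × F => (p.1, c p.1 + p.2) := by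
    funext x
    rw [Measure.map_map (by fun_prop) (by fun_prop), Measure.map_map hf (by fun_prop)]
    rfl
  ext t ht
  have hker : Measurable fun x =>
      (ν.map (Prod.mk x)).map fun p : E × F => (p.1, c p.1 + p.2) :=
    (Measure.measurable_map _ hf).comp Measurable.map_prodMk_left
  rw [hmap, Measure.bind_apply ht hker.aemeasurable,
    Measure.map_apply hf ht, Measure.prod_apply (hf ht)]
  congr with x
  rw [Measure.map_apply hf ht, Measure.map_apply (by fun_prop) (hf ht)]

/-- The joint law as the image of a product of Gaussian measures under a shear. -/
theorem jointLaw_eq_map_prod (ℓ s : ℕ) (μ : Fin ℓ → ℝ) (β ρ σ τ : ℝ) :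
    jointLaw ℓ s μ β ρ σ τ =
      ((lawX ℓ s μ τ).prod
        (Measure.pi fun _ => gaussianReal 0 ((1 - ρ ^ 2) * σ ^ 2).toNNReal)).map
        fun p => (p.1, (β • p.1 + (ρ * σ / τ) • (p.1 - Sum.elim μ (0 : Fin s → ℝ))) + p.2) := by
  rw [← bind_map_prodMk_map_add _ _
    (fun x : Fin ℓ ⊕ Fin s → ℝ => β • x + (ρ * σ / τ) • (x - Sum.elim μ (0 : Fin s → ℝ)))
    (by fun_prop), jointLaw]
  congr with x : 1
  congr 1
  have htranslate := Measure.pi_map_pi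
    (μ := fun _ : Fin ℓ ⊕ Fin s => gaussianReal 0 ((1 - ρ ^ 2) * σ ^ 2).toNNReal)
    (f := fun i r => (β • x + (ρ * σ / τ) • (x - Sum.elim μ (0 : Fin s → ℝ))) i + r)
    (fun i => by fun_prop)
  simp_rw [gaussianReal_map_const_add] at htranslate
  refine Eq.trans ?_ htranslate.symm
  simp [lawYgiven, mul_comm]

/-- invariance of the model. In the canonical two-stage model with
`θ = (β, μ, ρ, σ, τ)`, let `g_β ∈ ℝ`, `g_z ∈ O(ℓ)`, `g_r ∈ O(s)`, and
`q_g = blockdiag(g_z, g_r)`. Then the pushforward of `P_θ` under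
`(x, y) ↦ (q_g x, q_g (y + g_β x))` equals `P_{θ'}` with
`θ' = (β + g_β, g_z μ, ρ, σ, τ)`. -/
theorem jointLaw_invariant (ℓ s : ℕ) (hℓ : 1 ≤ ℓ) (hs : 1 ≤ s)
    (μ : Fin ℓ → ℝ) (β ρ σ τ : ℝ)
    (hρ₁ : -1 < ρ) (hρ₂ : ρ < 1) (hσ : 0 < σ) (hτ : 0 < τ)
    (gβ : ℝ) (gz : Matrix (Fin ℓ) (Fin ℓ) ℝ) (gr : Matrix (Fin s) (Fin s) ℝ)
    (hgz : gzᵀ * gz = 1) (hgr : grᵀ * gr = 1)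
    (qg : Matrix (Fin ℓ ⊕ Fin s) (Fin ℓ ⊕ Fin s) ℝ)
    (hqg : qg = Matrix.fromBlocks gz 0 0 gr) :
    (jointLaw ℓ s μ β ρ σ τ).map
        (fun xy : (Fin ℓ ⊕ Fin s → ℝ) × (Fin ℓ ⊕ Fin s → ℝ) =>
          (qg.mulVec xy.1, qg.mulVec (xy.2 + gβ • xy.1)))
      = jointLaw ℓ s (gz.mulVec μ) (β + gβ) ρ σ τ := by
  have hQ : qgᵀ * qg = 1 := by
    simp [hqg, fromBlocks_transpose, fromBlocks_multiply, hgz, hgr]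
  have hmean : qg.mulVec (Sum.elim μ (0 : Fin s → ℝ)) = Sum.elim (gz.mulVec μ) 0 := by
    simp [hqg, fromBlocks_mulVec]
  have hQm : Measurable qg.mulVec := qg.mulVecLin.continuous_of_finiteDimensional.measurable
  have hX : (lawX ℓ s μ τ).map qg.mulVec = lawX ℓ s (gz.mulVec μ) τ := by
    rw [lawX, pi_gaussianReal_map_mulVec qg hQ, hmean, lawX]
  have hW := pi_gaussianReal_map_mulVec qg hQ 0 ((1 - ρ ^ 2) * σ ^ 2).toNNReal
  simp only [mulVec_zero, Pi.zero_apply] at hW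
  have : IsProbabilityMeasure (lawX ℓ s μ τ) := by unfold lawX; infer_instance
  rw [jointLaw_eq_map_prod, jointLaw_eq_map_prod, ← hX]
  nth_rewrite 2 [← hW]
  rw [Measure.map_prod_map _ _ hQm hQm, Measure.map_map (by fun_prop) (by fun_prop),
    Measure.map_map (by fun_prop) (by fun_prop)]
  congr 1
  funext p
  simp only [Function.comp_apply, Prod.map_fst, Prod.map_snd, ← hmean, mulVec_add, mulVec_smul,
    mulVec_sub, add_smul]
  congr 1
  abel
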